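/- arXiv:1412.3500 — 4 statements merged into one kernel-verified Lean document; each statement's English description precedes it below -/
import Mathlib

section
/- Let K be a field, let n be a natural number, and let B be an infinite subset of K. Then the set of points of the prime spectrum of the polynomial ring K[X₁,…,Xₙ] whose associated prime ideal is of the form (X₁ − b₁, …, Xₙ − bₙ) for some b₁,…,bₙ ∈ B is dense in Spec K[X₁,…,Xₙ] (with the Zariski topology). -/
namespace MvPolynomial

theorem sub_C_eval_mem_span_X_sub_C {R σ : Type*} [CommRing R] (b : σ → R)
    (p : MvPolynomial σ R) :
    p - C (eval b p) ∈ Ideal.span (Set.range fun i => X i - C (b i)) := by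
  set I : Ideal (MvPolynomial σ R) := Ideal.span (Set.range fun i => X i - C (b i))
  have h : Ideal.Quotient.mk I = (Ideal.Quotient.mk I).comp (C.comp (eval b)) := by
    refine ringHom_ext (fun r => by simp) fun i => ?_
    have hi : X i - C (b i) ∈ I := Ideal.subset_span ⟨i, rfl⟩
    simpa using Ideal.Quotient.eq.mpr hi
  exact Ideal.Quotient.eq.mp (RingHom.congr_fun h p)

theorem ker_eval_eq_span_X_sub_C {R σ : Type*} [CommRing R] (b : σ → R) :
    RingHom.ker (eval b) = Ideal.span (Set.range fun i => X i - C (b i)) := by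
  refine le_antisymm (fun p hp => ?_) (Ideal.span_le.mpr ?_)
  · simpa [RingHom.mem_ker.mp hp] using sub_C_eval_mem_span_X_sub_C b p
  · rintro _ ⟨i, rfl⟩
    simp [RingHom.mem_ker]

end MvPolynomial

/-- For a field `K` and an infinite subset `B ⊆ K`, the set of points of
`Spec K[X₁,…,Xₙ]` of the form `(X₁ - b₁, …, Xₙ - bₙ)` with all `bᵢ ∈ B` is Zariski dense. -/
theorem stmt_2 (K : Type*) [Field K] (n : ℕ) (B : Set K) (hB : B.Infinite) :
    Dense {P : PrimeSpectrum (MvPolynomial (Fin n) K) |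
      ∃ b : Fin n → K, (∀ i, b i ∈ B) ∧
        P.asIdeal =
          Ideal.span (Set.range fun i => MvPolynomial.X i - MvPolynomial.C (b i))} := by
  rw [dense_iff_closure_eq, ← PrimeSpectrum.zeroLocus_vanishingIdeal_eq_closure,
    PrimeSpectrum.zeroLocus_eq_univ_iff]
  intro p hp
  suffices p = 0 by simp [this]
  refine MvPolynomial.funext_set (fun _ => B) (fun _ => hB) fun b hb => ?_
  have hmem := (PrimeSpectrum.mem_vanishingIdeal _ _).mp hp
    ⟨RingHom.ker (MvPolynomial.eval b), RingHom.ker_isPrime _⟩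
    ⟨b, fun i => hb i trivial, MvPolynomial.ker_eval_eq_span_X_sub_C b⟩
  simpa [RingHom.mem_ker] using hmem
end

section
/- Let K be a field, let n be a natural number, and let B be an infinite subset of K ∖ {0}. Consider the Laurent polynomial ring K[X₁^{±1},…,Xₙ^{±1}], realized as the localization of K[X₁,…,Xₙ] away from the element X₁⋯Xₙ. Then the set of points of the prime spectrum of K[X₁^{±1},…,Xₙ^{±1}] whose contraction to K[X₁,…,Xₙ] (along the localization map) equals the ideal (X₁ − b₁, …, Xₙ − bₙ) for some b₁,…,bₙ ∈ B is dense in Spec K[X₁^{±1},…,Xₙ^{±1}] (with the Zariski topology). -/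
/-- The kernel of evaluation at `b` is generated by the polynomials `X i - C (b i)`. -/
theorem MvPolynomial.ker_eval_eq_span {R σ : Type*} [CommRing R] (b : σ → R) :
    RingHom.ker (MvPolynomial.eval b) =
      Ideal.span (Set.range fun i => MvPolynomial.X i - MvPolynomial.C (b i)) := by
  apply le_antisymm
  · intro p hp
    set I := Ideal.span (Set.range fun i => (MvPolynomial.X i : MvPolynomial σ R) -
      MvPolynomial.C (b i))
    have hmk : Ideal.Quotient.mk I =
        ((Ideal.Quotient.mk I).comp MvPolynomial.C).comp (MvPolynomial.eval b) := by
      apply MvPolynomial.ringHom_ext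
      · intro r
        simp
      · intro i
        have hi : (MvPolynomial.X i : MvPolynomial σ R) - MvPolynomial.C (b i) ∈ I :=
          Ideal.subset_span ⟨i, rfl⟩
        simpa using Ideal.Quotient.eq.2 hi
    rw [← Ideal.Quotient.eq_zero_iff_mem, hmk, RingHom.comp_apply, RingHom.mem_ker.1 hp, map_zero]
  · rw [Ideal.span_le]
    rintro _ ⟨i, rfl⟩
    simp

/-- For a field `K` and an infinite subset `B ⊆ K ∖ {0}`, the set of points of the prime
spectrum of the Laurent polynomial ring `K[X₁^{±1},…,Xₙ^{±1}]` (realized as the localization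
of `K[X₁,…,Xₙ]` away from `X₁⋯Xₙ`) whose contraction to `K[X₁,…,Xₙ]` equals
`(X₁ - b₁, …, Xₙ - bₙ)` for some `bᵢ ∈ B` is Zariski dense. -/
theorem stmt_4 (K : Type*) [Field K] (n : ℕ) (B : Set K) (hB : B.Infinite)
    (hB0 : ∀ b ∈ B, b ≠ 0) :
    Dense {P : PrimeSpectrum
        (Localization.Away (∏ i : Fin n, (MvPolynomial.X i : MvPolynomial (Fin n) K))) |
      ∃ b : Fin n → K, (∀ i, b i ∈ B) ∧
        (PrimeSpectrum.comap (algebraMap (MvPolynomial (Fin n) K)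
            (Localization.Away
              (∏ i : Fin n, (MvPolynomial.X i : MvPolynomial (Fin n) K)))) P).asIdeal =
          Ideal.span (Set.range fun i => MvPolynomial.X i - MvPolynomial.C (b i))} := by
  rw [PrimeSpectrum.isTopologicalBasis_basic_opens.dense_iff]
  rintro _ ⟨f, rfl⟩ ⟨Q, hQ⟩
  obtain ⟨⟨g, s⟩, hgs⟩ := IsLocalization.surj
    (Submonoid.powers (∏ i : Fin n, (MvPolynomial.X i : MvPolynomial (Fin n) K))) f
  have hg : g ≠ 0 := by
    rintro rfl
    rw [map_zero, (IsLocalization.map_units _ s).mul_left_eq_zero] at hgs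
    exact hQ (hgs ▸ Q.asIdeal.zero_mem)
  obtain ⟨b, hb, hbg⟩ : ∃ b : Fin n → K, (∀ i, b i ∈ B) ∧ MvPolynomial.eval b g ≠ 0 := by
    by_contra! h
    exact hg (MvPolynomial.funext_set (fun _ => B) (fun _ => hB)
      fun x hx => by simpa using h x fun i => hx i trivial)
  have hunit : IsUnit (MvPolynomial.eval b
      (∏ i : Fin n, (MvPolynomial.X i : MvPolynomial (Fin n) K))) := by
    simpa [map_prod, Finset.prod_eq_zero_iff] using fun i => hB0 _ (hb i)
  let φ := IsLocalization.Away.lift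
    (S := Localization.Away (∏ i : Fin n, (MvPolynomial.X i : MvPolynomial (Fin n) K))) _ hunit
  have hφ : φ.comp (algebraMap _ _) = MvPolynomial.eval b := IsLocalization.Away.lift_comp _ hunit
  refine ⟨⟨RingHom.ker φ, RingHom.ker_isPrime φ⟩, fun hf => hbg ?_, b, hb, ?_⟩
  · rw [← hφ, RingHom.comp_apply, ← hgs, map_mul, RingHom.mem_ker.1 hf, zero_mul]
  · rw [PrimeSpectrum.comap_asIdeal, RingHom.comap_ker, hφ, MvPolynomial.ker_eval_eq_span]
end

section
/- Let R be a reduced commutative ring, let r be a natural number, let M be an R-module equipped with an injective R-linear map ι : M → R^r, and let H ∈ M be a nonzero element with coordinates h₁,…,h_r ∈ R (so hᵢ is the i-th component of ι(H)). Then: (i) every prime ideal 𝔮 of R such that H lies in the submodule 𝔮·M contains all of h₁,…,h_r; consequently the set {𝔮 ∈ Spec R : H ∈ 𝔮·M} is contained in the Zariski-closed set V(h₁,…,h_r), and V(h₁,…,h_r) is a proper subset of Spec R; (ii) moreover, if t ∈ R is a nonzerodivisor, then there exists a prime ideal 𝔮 of R with t ∉ 𝔮 and H ∉ 𝔮·M.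 -/
/-- A linear functional maps `I • ⊤` into `I`. -/
theorem LinearMap.apply_mem_of_mem_ideal_smul_top {R M : Type*} [CommRing R] [AddCommGroup M]
    [Module R M] (f : M →ₗ[R] R) {I : Ideal R} {x : M} (hx : x ∈ I • (⊤ : Submodule R M)) :
    f x ∈ I := by
  induction hx using Submodule.smul_induction_on' with
  | smul a ha m _ => simpa using I.mul_mem_right (f m) ha
  | add x _ y _ hx hy => simpa using I.add_mem hx hy

/-- In a reduced ring, a nonzero element lies outside some prime ideal. -/
theorem exists_isPrime_notMem_of_ne_zero {R : Type*} [CommRing R] [IsReduced R] {x : R}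
    (hx : x ≠ 0) : ∃ 𝔮 : Ideal R, 𝔮.IsPrime ∧ x ∉ 𝔮 := by
  by_contra! h
  exact hx (nilpotent_iff_mem_prime.mpr h).eq_zero


/-- Let `R` be a reduced commutative ring, `M` an `R`-module with an injective `R`-linear map
`ι : M → Rʳ`, and `H ∈ M` nonzero with coordinates `hᵢ = ι H i`. Then:
(i) every prime `𝔮` with `H ∈ 𝔮·M` contains all the `hᵢ`; consequently
`{𝔮 | H ∈ 𝔮·M} ⊆ V(h₁,…,h_r)` and `V(h₁,…,h_r) ≠ Spec R`;
(ii) for every nonzerodivisor `t ∈ R` there is a prime `𝔮` with `t ∉ 𝔮` and `H ∉ 𝔮·M`. -/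
theorem stmt_5 (R : Type*) [CommRing R] [IsReduced R] (r : ℕ)
    (M : Type*) [AddCommGroup M] [Module R M]
    (ι : M →ₗ[R] (Fin r → R)) (hι : Function.Injective ι)
    (H : M) (hH : H ≠ 0) :
    (∀ 𝔮 : Ideal R, 𝔮.IsPrime → H ∈ 𝔮 • (⊤ : Submodule R M) → ∀ i : Fin r, ι H i ∈ 𝔮) ∧
    {P : PrimeSpectrum R | H ∈ P.asIdeal • (⊤ : Submodule R M)} ⊆
      PrimeSpectrum.zeroLocus (Set.range fun i : Fin r => ι H i) ∧
    PrimeSpectrum.zeroLocus (Set.range fun i : Fin r => ι H i) ≠ Set.univ ∧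
    (∀ t : R, t ∈ nonZeroDivisors R →
      ∃ 𝔮 : Ideal R, 𝔮.IsPrime ∧ t ∉ 𝔮 ∧ H ∉ 𝔮 • (⊤ : Submodule R M)) := by
  have coord_mem : ∀ 𝔮 : Ideal R, 𝔮.IsPrime → H ∈ 𝔮 • (⊤ : Submodule R M) →
      ∀ i : Fin r, ι H i ∈ 𝔮 := fun 𝔮 _ h i =>
    (LinearMap.proj i ∘ₗ ι).apply_mem_of_mem_ideal_smul_top h
  obtain ⟨i, hi⟩ : ∃ i, ι H i ≠ 0 :=
    Function.ne_iff.mp ((map_ne_zero_iff ι hι).mpr hH)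
  refine ⟨coord_mem, ?_, ?_, ?_⟩
  · rintro P hP _ ⟨j, rfl⟩
    exact coord_mem P.asIdeal P.isPrime hP j
  · intro h
    obtain ⟨𝔮, h𝔮, hi𝔮⟩ := exists_isPrime_notMem_of_ne_zero hi
    have hP : (⟨𝔮, h𝔮⟩ : PrimeSpectrum R) ∈
        PrimeSpectrum.zeroLocus (Set.range fun i : Fin r => ι H i) := h ▸ Set.mem_univ _
    exact hi𝔮 (hP ⟨i, rfl⟩)
  · intro t ht
    obtain ⟨𝔮, h𝔮, hti⟩ := exists_isPrime_notMem_of_ne_zero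
      (mt (mul_left_mem_nonZeroDivisors_eq_zero_iff ht).mp hi)
    exact ⟨𝔮, h𝔮, fun h => hti (𝔮.mul_mem_right _ h),
      fun h => hti (𝔮.mul_mem_left _ (coord_mem 𝔮 h𝔮 h i))⟩
end

section
/- Let F be a field and let n ≥ 2. Let P denote the set of matrices in GLₙ(F) whose last row is (0, 0, …, 0, 1), and let ᵗP denote the set of matrices in GLₙ(F) whose last column is (0, 0, …, 0, 1)ᵀ. Then the subgroup of GLₙ(F) generated by P ∪ ᵗP is all of GLₙ(F). -/
namespace Matrix

variable {n F : Type*} [Fintype n] [DecidableEq n] [Field F]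

/-- Let `l` be an index. A subgroup of `GL n F` that contains all matrices whose `l`-th row or `l`-th
column is the standard one contains all transvections. -/
theorem mem_of_val_eq_transvection {H : Subgroup (GL n F)} {l : n}
    (hrow : ∀ g : GL n F, (∀ j, g.val l j = if j = l then 1 else 0) → g ∈ H)
    (hcol : ∀ g : GL n F, (∀ i, g.val i l = if i = l then 1 else 0) → g ∈ H)
    {i j : n} (hij : i ≠ j) (c : F) {g : GL n F} (hg : g.val = transvection i j c) : g ∈ H := by
  by_cases hi : i = l
  · subst hi
    refine hcol g fun k => ?_
    simp [hg, transvection, one_apply, hij.symm]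
  · refine hrow g fun k => ?_
    simp [hg, transvection, one_apply, hi, eq_comm]

/-- The transvection `1 + c • E i j`, as an element of the general linear group. -/
noncomputable def transvectionGL {i j : n} (hij : i ≠ j) (c : F) : GL n F :=
  GeneralLinearGroup.mkOfDetNeZero (transvection i j c) (by simp [det_transvection_of_ne i j hij])

theorem val_transvectionGL {i j : n} (hij : i ≠ j) (c : F) :
    (transvectionGL hij c).val = transvection i j c :=
  rfl

/-- Let `l` be an index which is not the only one. A subgroup of `GL n F` that contains all matrices
whose `l`-th row or `l`-th column is the standard one contains all diagonal matrices. -/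
theorem mem_of_val_eq_diagonal [Nontrivial n] {H : Subgroup (GL n F)} {l : n}
    (hrow : ∀ g : GL n F, (∀ j, g.val l j = if j = l then 1 else 0) → g ∈ H)
    (hcol : ∀ g : GL n F, (∀ i, g.val i l = if i = l then 1 else 0) → g ∈ H)
    {d : n → F} {g : GL n F} (hg : g.val = diagonal d) : g ∈ H := by
  obtain ⟨i, hil⟩ := exists_ne l
  have hd : d l ≠ 0 := by
    have hdet : (diagonal d).det ≠ 0 := hg ▸ g.det_ne_zero
    rw [det_diagonal, Finset.prod_ne_zero_iff] at hdet
    exact hdet l (Finset.mem_univ l)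
  have hmem {i j : n} (hij : i ≠ j) (c : F) : transvectionGL hij c ∈ H :=
    mem_of_val_eq_transvection hrow hcol hij c (val_transvectionGL hij c)
  -- Column operations turn the `l`-th row of `g` into the standard one.
  rw [← H.mul_mem_cancel_right (hmem hil.symm 1),
    ← H.mul_mem_cancel_right (hmem hil ((d l)⁻¹ - 1)),
    ← H.mul_mem_cancel_right (hmem hil.symm (-d l))]
  refine hrow _ fun k => ?_
  simp only [Units.val_mul, val_transvectionGL, hg]
  by_cases hki : k = i
  · subst hki
    simp [hil, hil.symm]
    field_simp
    ring
  · by_cases hkl : k = l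
    · subst hkl
      simp [hil.symm]
      field_simp
      ring
    · simp [hki, hkl, Ne.symm hkl]

/-- Let `l` be an index which is not the only one. A subgroup of `GL n F` that contains all matrices
whose `l`-th row or `l`-th column is the standard one is the whole group. -/
theorem eq_top_of_row_of_col [Nontrivial n] {H : Subgroup (GL n F)} {l : n}
    (hrow : ∀ g : GL n F, (∀ j, g.val l j = if j = l then 1 else 0) → g ∈ H)
    (hcol : ∀ g : GL n F, (∀ i, g.val i l = if i = l then 1 else 0) → g ∈ H) : H = ⊤ := by
  refine (Subgroup.eq_top_iff' H).2 fun g => ?_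
  refine diagonal_transvection_induction_of_det_ne_zero
    (fun M => ∀ g : GL n F, g.val = M → g ∈ H) g.val g.det_ne_zero ?_ ?_ ?_ g rfl
  · exact fun d _ g hg => mem_of_val_eq_diagonal hrow hcol hg
  · exact fun t g hg => mem_of_val_eq_transvection hrow hcol t.hij t.c hg
  · intro A B hA hB ihA ihB g hg
    have hmul : g = GeneralLinearGroup.mkOfDetNeZero A hA *
        GeneralLinearGroup.mkOfDetNeZero B hB := Units.ext hg
    rw [hmul]
    exact H.mul_mem (ihA _ rfl) (ihB _ rfl)

end Matrix

/-- For a field `F` and `n ≥ 2`, the subgroup of `GLₙ(F)` generated by the mirabolic subgroup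
`P` (matrices whose last row is `(0,…,0,1)`) together with its transpose `ᵗP` (matrices whose
last column is `(0,…,0,1)ᵀ`) is all of `GLₙ(F)`. -/
theorem stmt_8 (F : Type*) [Field F] (n : ℕ) (hn : 2 ≤ n) :
    Subgroup.closure
      ({M : GL (Fin n) F | ∀ j : Fin n,
          (M : Matrix (Fin n) (Fin n) F) ⟨n - 1, by omega⟩ j =
            if j = ⟨n - 1, by omega⟩ then 1 else 0} ∪
       {M : GL (Fin n) F | ∀ i : Fin n,
          (M : Matrix (Fin n) (Fin n) F) i ⟨n - 1, by omega⟩ =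
            if i = ⟨n - 1, by omega⟩ then 1 else 0}) = ⊤ := by
  have : Nontrivial (Fin n) := Fin.nontrivial_iff_two_le.2 hn
  exact Matrix.eq_top_of_row_of_col (l := ⟨n - 1, by omega⟩)
    (fun g hg => Subgroup.subset_closure (Or.inl hg))
    (fun g hg => Subgroup.subset_closure (Or.inr hg))
end
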